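/- For every real x with 0 < x ≤ 1, the limit as n → ∞ of n · Σ_{k=1}^{n} p_{n,k}(x) · R(n,k) equals 0. -/

import Mathlib

open Filter Finset

/-- Bernstein basis polynomial `p_{n,k}(x) = C(n,k) x^k (1-x)^{n-k}`. -/
noncomputable def bern (n k : ℕ) (x : ℝ) : ℝ := (n.choose k : ℝ) * x ^ k * (1 - x) ^ (n - k)

/-- `R(n,k) = k/n - √(k(k-1)/(n(n-1))) - 1/(2n) + k/(2n²)` -/
noncomputable def R (n k : ℕ) : ℝ :=
  (k : ℝ) / n - Real.sqrt ((k * (k - 1)) / (n * (n - 1))) - 1 / (2 * n) + k / (2 * n ^ 2)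

/-- Second-order two-sided bound for `√(1 - t)` on `[0, 1]`. -/
lemma sqrt_one_sub_bounds {t : ℝ} (h0 : 0 ≤ t) (h1 : t ≤ 1) :
    1 - t / 2 - t ^ 2 / 2 ≤ √(1 - t) ∧ √(1 - t) ≤ 1 - t / 2 := by
  constructor
  · apply Real.le_sqrt_of_sq_le
    have h : (1 - t / 2 - t ^ 2 / 2) ^ 2 = (1 - t) * (1 - (3 * t ^ 2 / 4 + t ^ 3 / 4)) := by ring
    rw [h]
    have : 0 ≤ (1 - t) * (3 * t ^ 2 / 4 + t ^ 3 / 4) :=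
      mul_nonneg (by linarith) (by positivity)
    linarith
  · rw [Real.sqrt_le_left (by linarith)]
    nlinarith [sq_nonneg t]

lemma mul_R_bounds {n k : ℕ} (hn : 2 ≤ n) (hk : 1 ≤ k) (hkn : k ≤ n) :
    0 ≤ (n : ℝ) * R n k ∧ (n : ℝ) * R n k ≤ 2 / (k + 1) := by
  have hn' : (2 : ℝ) ≤ n := by exact_mod_cast hn
  have hk' : (1 : ℝ) ≤ k := by exact_mod_cast hk
  have hkn' : (k : ℝ) ≤ n := by exact_mod_cast hkn
  unfold R
  generalize (n : ℝ) = m at *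
  generalize (k : ℝ) = j at *
  have hm0 : 0 < m := by linarith
  have hm1 : 0 < m - 1 := by linarith
  have hj0 : 0 < j := by linarith
  obtain ⟨t, ht⟩ : ∃ t, t = (m - j) / ((m - 1) * j) := ⟨_, rfl⟩
  have ht0 : 0 ≤ t := ht ▸ div_nonneg (by linarith) (by positivity)
  have htj : t ≤ 1 / j := by
    rw [ht, div_le_div_iff₀ (by positivity) hj0]
    nlinarith
  have ht1 : t ≤ 1 := htj.trans (by rw [div_le_one hj0]; exact hk')
  have hsq : j * (j - 1) / (m * (m - 1)) = (j / m) ^ 2 * (1 - t) := by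
    rw [ht]; field_simp; ring
  rw [hsq, Real.sqrt_mul (sq_nonneg _), Real.sqrt_sq (by positivity)]
  obtain ⟨hlo, hhi⟩ := sqrt_one_sub_bounds ht0 ht1
  have hexp : m * (j / m - j / m * √(1 - t) - 1 / (2 * m) + j / (2 * m ^ 2)) =
      j * (1 - √(1 - t)) - (m - j) / (2 * m) := by
    field_simp; ring
  have hjt : j * t = (m - j) / (m - 1) := by rw [ht]; field_simp
  have hdiff : (m - j) / (m - 1) - (m - j) / m = (m - j) / (m * (m - 1)) := by
    field_simp; ring
  have hhalf : (m - j) / (2 * m) = (m - j) / m / 2 := by field_simp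
  have hd0 : 0 ≤ (m - j) / (m * (m - 1)) := div_nonneg (by linarith) (by positivity)
  have hd1 : (m - j) / (m * (m - 1)) ≤ 1 / j := by
    rw [div_le_div_iff₀ (by positivity) hj0]
    nlinarith
  have hjt2 : j * t ^ 2 ≤ 1 / j := by
    calc j * t ^ 2 ≤ j * (1 / j) ^ 2 := by gcongr
      _ = 1 / j := by field_simp
  have hj2 : 1 / j ≤ 2 / (j + 1) := by
    rw [div_le_div_iff₀ hj0 (by positivity)]
    linarith
  rw [hexp, hhalf]
  constructor
  · nlinarith [mul_le_mul_of_nonneg_left hhi hj0.le]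
  · nlinarith [mul_le_mul_of_nonneg_left hlo hj0.le]

lemma bern_nonneg {x : ℝ} (hx0 : 0 ≤ x) (hx1 : x ≤ 1) (n k : ℕ) : 0 ≤ bern n k x := by
  have : 0 ≤ 1 - x := by linarith
  unfold bern
  positivity

lemma bern_div_succ {x : ℝ} (hx : x ≠ 0) (n k : ℕ) :
    bern n k x / (k + 1) = bern (n + 1) (k + 1) x / ((n + 1) * x) := by
  have h : ((n : ℝ) + 1) * n.choose k = (n + 1).choose (k + 1) * (k + 1) := by
    exact_mod_cast Nat.add_one_mul_choose_eq n k
  unfold bern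
  rw [Nat.add_sub_add_right, div_eq_div_iff (by positivity)
    (mul_ne_zero (by positivity) hx)]
  linear_combination x ^ (k + 1) * (1 - x) ^ (n - k) * h

lemma sum_bern (n : ℕ) (x : ℝ) : ∑ k ∈ range (n + 1), bern n k x = 1 := by
  have h := add_pow x (1 - x) n
  rw [add_sub_cancel, one_pow] at h
  rw [h]
  exact sum_congr rfl fun k _ => by unfold bern; ring

lemma sum_bern_div_succ_le {x : ℝ} (hx0 : 0 < x) (hx1 : x ≤ 1) (n : ℕ) :
    ∑ k ∈ Icc 1 n, bern n k x / (k + 1) ≤ 1 / ((n + 1) * x) := by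
  calc ∑ k ∈ Icc 1 n, bern n k x / (k + 1)
      ≤ ∑ k ∈ range (n + 1), bern n k x / (k + 1) := by
        refine sum_le_sum_of_subset_of_nonneg (fun k hk => ?_) fun k _ _ =>
          div_nonneg (bern_nonneg hx0.le hx1 n k) (by positivity)
        rw [mem_Icc] at hk
        exact mem_range.2 (by lia)
    _ = (∑ k ∈ range (n + 1), bern (n + 1) (k + 1) x) / ((n + 1) * x) := by
        rw [sum_div]
        exact sum_congr rfl fun k _ => bern_div_succ hx0.ne' n k
    _ ≤ 1 / ((n + 1) * x) := by
        gcongr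
        have h := sum_bern (n + 1) x
        rw [sum_range_succ'] at h
        linarith [bern_nonneg hx0.le hx1 (n + 1) 0]

theorem stmt_3 (x : ℝ) (hx0 : 0 < x) (hx1 : x ≤ 1) :
    Tendsto (fun n : ℕ => (n : ℝ) * ∑ k ∈ Finset.Icc 1 n, bern n k x * R n k)
      atTop (nhds 0) := by
  have hlim : Tendsto (fun n : ℕ => 2 / x * (1 / ((n : ℝ) + 1))) atTop (nhds 0) := by
    simpa using tendsto_one_div_add_atTop_nhds_zero_nat.const_mul (2 / x)
  refine tendsto_of_tendsto_of_tendsto_of_le_of_le' tendsto_const_nhds hlim ?_ ?_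
  all_goals
    filter_upwards [eventually_ge_atTop 2] with n hn
    have hR : ∀ k ∈ Icc 1 n, 0 ≤ (n : ℝ) * R n k ∧ (n : ℝ) * R n k ≤ 2 / (k + 1) :=
      fun k hk => mul_R_bounds hn (mem_Icc.1 hk).1 (mem_Icc.1 hk).2
    simp only [mul_sum, mul_left_comm (n : ℝ)]
  · exact sum_nonneg fun k hk => mul_nonneg (bern_nonneg hx0.le hx1 n k) (hR k hk).1
  · calc ∑ k ∈ Icc 1 n, bern n k x * (n * R n k)
        ≤ ∑ k ∈ Icc 1 n, bern n k x * (2 / (k + 1)) := sum_le_sum fun k hk =>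
          mul_le_mul_of_nonneg_left (hR k hk).2 (bern_nonneg hx0.le hx1 n k)
      _ = 2 * ∑ k ∈ Icc 1 n, bern n k x / (k + 1) := by
          rw [mul_sum]
          exact sum_congr rfl fun k _ => by ring
      _ ≤ 2 * (1 / ((n + 1) * x)) := by
          gcongr
          exact sum_bern_div_succ_le hx0 hx1 n
      _ = 2 / x * (1 / ((n : ℝ) + 1)) := by field_simp
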